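/- Suppose (G_n, c_n) satisfies Assumption (LL) for some K > 1, γ_n > 0 and δ_n → 0, with G_n simple and c_n connected. Then for every fixed radius r, the sizes of the r-balls in the weighted spanning tree around a uniform vertex are tight: lim_{M→∞} sup_n P(|B_{WST(c_n)}(X, r)| ≥ M) = 0, where X is a uniform random vertex of V(G_n) and B denotes graph-distance balls in the tree WST(c_n). -/

import Mathlib

open MeasureTheory Filter Finset

noncomputable section

set_option linter.unusedSectionVars false

namespace WSTPaper

variable {V : Type} [Fintype V] [DecidableEq V]

/-- The conductance `C_v = Σ_{u ~ v} c(u,v)` of a vertex in the electric network `(G, c)`. -/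
def vertCond (G : SimpleGraph V) [DecidableRel G.Adj] (c : Sym2 V → ℝ) (v : V) : ℝ :=
  ∑ u ∈ G.neighborFinset v, c s(u, v)

open scoped Classical in
/-- The edge sets of spanning trees of `G`. -/
def spanningTrees (G : SimpleGraph V) : Finset (Finset (Sym2 V)) :=
  Finset.univ.filter
    (fun T => ↑T ⊆ G.edgeSet ∧ (SimpleGraph.fromEdgeSet (↑T : Set (Sym2 V))).IsTree)

/-- Weight of a spanning tree: product of its edge conductances. -/
def treeWeight (c : Sym2 V → ℝ) (T : Finset (Sym2 V)) : ℝ := ∏ e ∈ T, c e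

/-- Partition function of the weighted spanning tree measure. -/
def partZ (G : SimpleGraph V) (c : Sym2 V → ℝ) : ℝ := ∑ T ∈ spanningTrees G, treeWeight c T

/-- The ball of radius `r` around `x` in `G`, as a set of vertices. -/
def ballSet (G : SimpleGraph V) (x : V) (r : ℕ) : Set V :=
  {y | G.Reachable x y ∧ G.dist x y ≤ r}

open scoped Classical in
/-- `P(|B_{WST(c)}(X, r)| ≥ M)`, for `X` a uniform random vertex. -/
def wstBallBigProb (G : SimpleGraph V) (c : Sym2 V → ℝ) (r : ℕ) (M : ℕ) : ℝ :=
  (Fintype.card V : ℝ)⁻¹ *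
    ∑ x : V, (∑ T ∈ spanningTrees G,
      if M ≤ (ballSet (SimpleGraph.fromEdgeSet (↑T : Set (Sym2 V))) x r).ncard
        then treeWeight c T else 0) / partZ G c

section FunctionalGraphs

/-- A partial map is acyclic if every orbit eventually leaves the domain. -/
def IsAcyclicMap (f : V → Option V) : Prop :=
  ∀ u, ∃ k, (fun o : Option V => o.bind f)^[k] (some u) = none

/-- The adjacency matrix of the functional digraph of a partial map. -/
def stepMatrix (f : V → Option V) : Matrix V V ℝ :=
  Matrix.of fun u x => if f u = some x then 1 else 0

lemma iterate_bind_none (f : V → Option V) (k : ℕ) :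
    (fun o : Option V => o.bind f)^[k] none = none := by
  induction k with
  | zero => rfl
  | succ k ih => rw [Function.iterate_succ_apply]; exact ih

lemma iterate_bind_mono {f : V → Option V} {o : Option V} {k l : ℕ} (hkl : k ≤ l)
    (h : (fun o : Option V => o.bind f)^[k] o = none) :
    (fun o : Option V => o.bind f)^[l] o = none := by
  obtain ⟨m, rfl⟩ := Nat.exists_eq_add_of_le hkl
  rw [Nat.add_comm, Function.iterate_add_apply, h, iterate_bind_none]

lemma stepMatrix_pow_apply (f : V → Option V) (k : ℕ) (u x : V) :
    (stepMatrix f ^ k) u x =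
      if (fun o : Option V => o.bind f)^[k] (some u) = some x then 1 else 0 := by
  induction k generalizing u with
  | zero => simp [Matrix.one_apply]
  | succ k ih =>
    rw [pow_succ', Matrix.mul_apply]
    simp only [ih, Function.iterate_succ_apply, Option.bind_some]
    simp only [stepMatrix, Matrix.of_apply]
    obtain h | ⟨y, h⟩ := Option.eq_none_or_eq_some (f u)
    · simp [h, iterate_bind_none]
    · simp only [h, Option.some_inj, ite_mul, one_mul, zero_mul, Finset.sum_ite_eq,
        Finset.mem_univ, if_true]

lemma det_one_sub_of_isNilpotent {N : Matrix V V ℝ} (hN : IsNilpotent N) : (1 - N).det = 1 := by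
  have h := (Matrix.isNilpotent_charpoly_sub_pow_of_isNilpotent hN).eq_zero
  have h2 := Matrix.eval_charpoly N 1
  rw [sub_eq_zero.1 h] at h2
  simpa using h2.symm

lemma det_one_sub_stepMatrix_of_isAcyclicMap {f : V → Option V} (hf : IsAcyclicMap f) :
    (1 - stepMatrix f).det = 1 := by
  apply det_one_sub_of_isNilpotent
  choose k hk using hf
  refine ⟨∑ u, k u, ?_⟩
  ext u x
  have := iterate_bind_mono
    (Finset.single_le_sum (f := k) (fun _ _ => Nat.zero_le _) (Finset.mem_univ u)) (hk u)
  rw [stepMatrix_pow_apply, this]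
  simp

open scoped Classical in
lemma det_one_sub_stepMatrix_of_not_isAcyclicMap {f : V → Option V} (hf : ¬ IsAcyclicMap f) :
    (1 - stepMatrix f).det = 0 := by
  unfold IsAcyclicMap at hf
  push Not at hf
  obtain ⟨u₀, hu₀⟩ := hf
  rw [← Matrix.exists_mulVec_eq_zero_iff]
  let P : V → Prop := fun u => ∃ k, (fun o : Option V => o.bind f)^[k] (some u) = none
  have hP : ∀ u y, f u = some y → (P u ↔ P y) := by
    intro u y h
    constructor
    · rintro ⟨k, hk⟩
      exact ⟨k, by
        have := iterate_bind_mono (Nat.le_succ k) hk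
        simpa [Function.iterate_succ_apply, h] using this⟩
    · rintro ⟨k, hk⟩
      exact ⟨k + 1, by simpa [Function.iterate_succ_apply, h] using hk⟩
  have hPn : ∀ u, f u = none → P u := fun u h => ⟨1, by simp [h]⟩
  refine ⟨fun u => if P u then 0 else 1, ?_, ?_⟩
  · intro h
    have := congrFun h u₀
    have hn : ¬ P u₀ := by rintro ⟨k, hk⟩; exact hu₀ k hk
    simp [hn] at this
  · ext u
    rw [Matrix.sub_mulVec, Matrix.one_mulVec, Pi.sub_apply]
    simp only [Matrix.mulVec, dotProduct, stepMatrix, Matrix.of_apply, Pi.zero_apply]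
    cases h : f u with
    | none => simp [hPn u h]
    | some y => simp only [Option.some_inj, ite_mul, one_mul, zero_mul, Finset.sum_ite_eq,
        Finset.mem_univ, if_true, hP u y h, sub_self]

open scoped Classical in
/-- Expansion of the determinant of a Laplacian with killing over acyclic partial maps. -/
lemma det_laplacian_eq_sum_acyclic (a : V → Option V → ℝ) :
    (Matrix.of fun u x => ∑ o : Option V, a u o *
        ((if u = x then (1 : ℝ) else 0) - if o = some x then 1 else 0)).det =
      ∑ f ∈ Finset.univ.filter (fun f : V → Option V => IsAcyclicMap f), ∏ u, a u (f u) := by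
  have h1 : (Matrix.of fun u x => ∑ o : Option V, a u o *
        ((if u = x then (1 : ℝ) else 0) - if o = some x then 1 else 0)) =
      (fun u => ∑ o : Option V, a u o •
        (fun x => ((if u = x then (1 : ℝ) else 0) - if o = some x then 1 else 0))) := by
    ext u x
    simp [Finset.sum_apply]
  rw [h1]
  change Matrix.detRowAlternating _ = _
  rw [← AlternatingMap.coe_multilinearMap, MultilinearMap.map_sum]
  rw [Finset.sum_filter]
  refine Finset.sum_congr rfl fun f _ => ?_
  rw [MultilinearMap.map_smul_univ, AlternatingMap.coe_multilinearMap]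
  have h2 : (Matrix.detRowAlternating fun u x =>
      ((if u = x then (1 : ℝ) else 0) - if f u = some x then 1 else 0)) =
      (1 - stepMatrix f).det := by
    congr 1
  rw [h2]
  split_ifs with hf
  · simp [det_one_sub_stepMatrix_of_isAcyclicMap hf]
  · simp [det_one_sub_stepMatrix_of_not_isAcyclicMap hf]

end FunctionalGraphs

section MatrixTree

lemma IsAcyclicMap.not_of_forall_step {f : V → Option V} (hf : IsAcyclicMap f) {P : V → Prop}
    (hP : ∀ u, P u → ∃ y, f u = some y ∧ P y) (u : V) : ¬ P u := by
  intro hu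
  obtain ⟨k, hk⟩ := hf u
  have : ∀ k u, P u → (fun o : Option V => o.bind f)^[k] (some u) ≠ none := by
    intro k
    induction k with
    | zero => simp
    | succ k ih =>
      intro u hu
      obtain ⟨y, hy, hPy⟩ := hP u hu
      rw [Function.iterate_succ_apply, Option.bind_some, hy]
      exact ih y hPy
  exact this k u hu hk

lemma IsAcyclicMap.no_two_cycle {f : V → Option V} (hf : IsAcyclicMap f) {u x : V}
    (hu : f u = some x) (hx : f x = some u) : False := by
  refine hf.not_of_forall_step (P := fun z => z = u ∨ z = x) ?_ u (Or.inl rfl)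
  rintro z (rfl | rfl)
  · exact ⟨x, hu, Or.inr rfl⟩
  · exact ⟨u, hx, Or.inl rfl⟩

/-- The parent maps of spanning trees of `G` rooted at `o`. -/
def IsParentMap (G : SimpleGraph V) (o : V) (f : V → Option V) : Prop :=
  IsAcyclicMap f ∧ f o = none ∧ ∀ u, u ≠ o → ∃ x, f u = some x ∧ G.Adj u x

/-- The edges `{u, f u}` of a parent map. -/
def parentEdges (o : V) (f : V → Option V) : Finset (Sym2 V) :=
  (Finset.univ.erase o).image fun u => s(u, (f u).getD u)

lemma IsParentMap.injOn {G : SimpleGraph V} {o : V} {f : V → Option V} (hf : IsParentMap G o f) :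
    Set.InjOn (fun u => s(u, (f u).getD u)) (Finset.univ.erase o : Finset V) := by
  intro u hu x hx h
  have hu' : u ≠ o := by simpa using hu
  have hx' : x ≠ o := by simpa using hx
  obtain ⟨y, hy, -⟩ := hf.2.2 u hu'
  obtain ⟨z, hz, -⟩ := hf.2.2 x hx'
  simp only [hy, hz, Option.getD_some, Sym2.eq_iff] at h
  rcases h with ⟨h, -⟩ | ⟨h1, h2⟩
  · exact h
  · subst h1 h2
    exact (hf.1.no_two_cycle hy hz).elim

lemma IsParentMap.card_parentEdges {G : SimpleGraph V} {o : V} {f : V → Option V}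
    (hf : IsParentMap G o f) : (parentEdges o f).card + 1 = Fintype.card V := by
  rw [parentEdges, Finset.card_image_of_injOn hf.injOn,
    Finset.card_erase_add_one (Finset.mem_univ o), Finset.card_univ]

lemma IsParentMap.mem_parentEdges {G : SimpleGraph V} {o : V} {f : V → Option V}
    (hf : IsParentMap G o f) {u x : V} (h : f u = some x) : s(u, x) ∈ parentEdges o f := by
  refine Finset.mem_image.2 ⟨u, ?_, by simp [h]⟩
  simp only [Finset.mem_erase, Finset.mem_univ, and_true]
  rintro rfl
  simp [hf.2.1] at h

lemma IsParentMap.exists_of_mem {G : SimpleGraph V} {o : V} {f : V → Option V}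
    (hf : IsParentMap G o f) {e : Sym2 V} (h : e ∈ parentEdges o f) :
    ∃ u x, f u = some x ∧ G.Adj u x ∧ e = s(u, x) := by
  obtain ⟨u, hu, rfl⟩ := Finset.mem_image.1 h
  obtain ⟨x, hx, hadj⟩ := hf.2.2 u (by simpa using hu)
  exact ⟨u, x, hx, hadj, by simp [hx]⟩

lemma mem_spanningTrees {G : SimpleGraph V} {T : Finset (Sym2 V)} :
    T ∈ spanningTrees G ↔
      (↑T ⊆ G.edgeSet ∧ (SimpleGraph.fromEdgeSet (↑T : Set (Sym2 V))).IsTree) := by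
  simp [spanningTrees]

lemma edgeSet_fromEdgeSet_of_subset {G : SimpleGraph V} {T : Finset (Sym2 V)}
    (h : (↑T : Set (Sym2 V)) ⊆ G.edgeSet) :
    (SimpleGraph.fromEdgeSet (↑T : Set (Sym2 V))).edgeSet = ↑T := by
  rw [SimpleGraph.edgeSet_fromEdgeSet]
  ext e
  simp only [Set.mem_sdiff, and_iff_left_iff_imp]
  intro he
  exact G.not_isDiag_of_mem_edgeSet (h he)

lemma card_add_one_of_mem_spanningTrees {G : SimpleGraph V} {T : Finset (Sym2 V)}
    (h : T ∈ spanningTrees G) : T.card + 1 = Fintype.card V := by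
  rw [mem_spanningTrees] at h
  have := (SimpleGraph.isTree_iff_connected_and_card.1 h.2).2
  rw [edgeSet_fromEdgeSet_of_subset h.1] at this
  simpa using this

lemma IsParentMap.parentEdges_mem {G : SimpleGraph V} {o : V} {f : V → Option V}
    (hf : IsParentMap G o f) : parentEdges o f ∈ spanningTrees G := by
  have hsub : (↑(parentEdges o f) : Set (Sym2 V)) ⊆ G.edgeSet := by
    intro e he
    obtain ⟨u, x, -, hadj, rfl⟩ := hf.exists_of_mem he
    exact hadj
  refine mem_spanningTrees.2 ⟨hsub, SimpleGraph.isTree_iff_connected_and_card.2 ⟨?_, ?_⟩⟩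
  · rw [SimpleGraph.connected_iff_exists_forall_reachable]
    refine ⟨o, fun w => ?_⟩
    by_contra hw
    refine hf.1.not_of_forall_step
      (P := fun u => ¬ (SimpleGraph.fromEdgeSet (↑(parentEdges o f) : Set (Sym2 V))).Reachable o u)
      ?_ w hw
    intro u hu
    have huo : u ≠ o := by rintro rfl; exact hu (SimpleGraph.Reachable.refl _)
    obtain ⟨x, hx, hadj⟩ := hf.2.2 u huo
    refine ⟨x, hx, fun h => hu (h.trans (SimpleGraph.Adj.reachable ?_))⟩
    rw [SimpleGraph.fromEdgeSet_adj]
    exact ⟨by rw [Sym2.eq_swap]; exact hf.mem_parentEdges hx, hadj.ne'⟩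
  · rw [edgeSet_fromEdgeSet_of_subset hsub]
    simpa using hf.card_parentEdges

lemma IsParentMap.parentEdges_injective {G : SimpleGraph V} {o : V} {f g : V → Option V}
    (hf : IsParentMap G o f) (hg : IsParentMap G o g) (h : parentEdges o f = parentEdges o g) :
    f = g := by
  ext1 w
  by_contra hw
  refine hf.1.not_of_forall_step (P := fun u => f u ≠ g u) ?_ w hw
  intro u hu
  have huo : u ≠ o := by rintro rfl; exact hu (hf.2.1.trans hg.2.1.symm)
  obtain ⟨y, hy, -⟩ := hf.2.2 u huo
  refine ⟨y, hy, fun hfg => ?_⟩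
  obtain ⟨u', z, hz, -, heq⟩ := hg.exists_of_mem (h ▸ hf.mem_parentEdges hy)
  rw [Sym2.eq_iff] at heq
  rcases heq with ⟨rfl, rfl⟩ | ⟨rfl, rfl⟩
  · exact hu (hy.trans hz.symm)
  · exact hf.1.no_two_cycle hy (hfg.trans hz)

lemma exists_isParentMap {G : SimpleGraph V} (o : V) {T : Finset (Sym2 V)}
    (hT : T ∈ spanningTrees G) : ∃ f, IsParentMap G o f ∧ parentEdges o f = T := by
  have hcard := card_add_one_of_mem_spanningTrees hT
  rw [mem_spanningTrees] at hT
  obtain ⟨hsub, htree⟩ := hT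
  set H := SimpleGraph.fromEdgeSet (↑T : Set (Sym2 V)) with hH
  have hconn := htree.connected
  have hstep : ∀ u, u ≠ o → ∃ y, H.Adj u y ∧ H.dist y o < H.dist u o := by
    intro u hu
    obtain ⟨p, hp⟩ := hconn.exists_walk_length_eq_dist u o
    cases p with
    | nil => exact (hu rfl).elim
    | cons hadj q =>
      refine ⟨_, hadj, ?_⟩
      have := SimpleGraph.dist_le q
      rw [SimpleGraph.Walk.length_cons] at hp
      omega
  choose! y hy hlt using hstep
  let f : V → Option V := fun u => if u = o then none else some (y u)
  have hfo : f o = none := by simp [f]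
  have hfu : ∀ u, u ≠ o → f u = some (y u) := fun u hu => by simp [f, hu]
  have hTadj : ∀ u, u ≠ o → s(u, y u) ∈ T := by
    intro u hu
    have := hy u hu
    rw [hH, SimpleGraph.fromEdgeSet_adj] at this
    exact_mod_cast this.1
  have hf : IsParentMap G o f := by
    refine ⟨?_, hfo, fun u hu => ⟨y u, hfu u hu, hsub (hTadj u hu)⟩⟩
    have : ∀ n u, H.dist u o = n → ∃ k, (fun o : Option V => o.bind f)^[k] (some u) = none := by
      intro n
      induction n using Nat.strong_induction_on with
      | _ n ih =>
        intro u hu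
        by_cases huo : u = o
        · exact ⟨1, by simp [huo, hfo]⟩
        · obtain ⟨k, hk⟩ := ih _ (hu ▸ hlt u huo) (y u) rfl
          exact ⟨k + 1, by rw [Function.iterate_succ_apply, Option.bind_some, hfu u huo, hk]⟩
    exact fun u => this _ u rfl
  refine ⟨f, hf, Finset.eq_of_subset_of_card_le ?_ ?_⟩
  · intro e he
    obtain ⟨u, hu, rfl⟩ := Finset.mem_image.1 he
    have huo : u ≠ o := by simpa using hu
    simpa [hfu u huo] using hTadj u huo
  · have := hf.card_parentEdges
    omega

open scoped Classical in
/-- The conductance matrix of a network. -/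
def netWeight (G : SimpleGraph V) (c : Sym2 V → ℝ) (x y : V) : ℝ :=
  if G.Adj x y then c s(x, y) else 0

/-- Transition weights of the network with unit killing at `o`. -/
def killedWeight (G : SimpleGraph V) (c : Sym2 V → ℝ) (o u : V) : Option V → ℝ
  | none => if u = o then 1 else 0
  | some x => netWeight G c u x

lemma IsAcyclicMap.isParentMap_of_prod_ne_zero {G : SimpleGraph V} {c : Sym2 V → ℝ} {o : V}
    {f : V → Option V} (hf : IsAcyclicMap f) (h : ∏ u, killedWeight G c o u (f u) ≠ 0) :
    IsParentMap G o f := by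
  rw [Finset.prod_ne_zero_iff] at h
  have hnone : ∀ u, f u = none → u = o := by
    intro u hu
    have := h u (Finset.mem_univ u)
    rw [hu] at this
    by_contra hne
    simp [killedWeight, hne] at this
  refine ⟨hf, ?_, fun u hu => ?_⟩
  · by_contra ho
    refine hf.not_of_forall_step (P := fun _ => True) (fun u _ => ?_) o trivial
    obtain hu | ⟨y, hy⟩ := Option.eq_none_or_eq_some (f u)
    · exact (ho (hnone u hu ▸ hu)).elim
    · exact ⟨y, hy, trivial⟩
  · obtain hu' | ⟨y, hy⟩ := Option.eq_none_or_eq_some (f u)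
    · exact (hu (hnone u hu')).elim
    · refine ⟨y, hy, ?_⟩
      have := h u (Finset.mem_univ u)
      rw [hy] at this
      by_contra hne
      simp [killedWeight, netWeight, hne] at this

lemma IsParentMap.prod_eq_treeWeight {G : SimpleGraph V} {c : Sym2 V → ℝ} {o : V}
    {f : V → Option V} (hf : IsParentMap G o f) :
    ∏ u, killedWeight G c o u (f u) = treeWeight c (parentEdges o f) := by
  rw [treeWeight, parentEdges, Finset.prod_image hf.injOn,
    ← Finset.mul_prod_erase Finset.univ _ (Finset.mem_univ o)]
  rw [hf.2.1]
  simp only [killedWeight, if_true, one_mul]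
  refine Finset.prod_congr rfl fun u hu => ?_
  obtain ⟨x, hx, hadj⟩ := hf.2.2 u (by simpa using hu)
  simp [hx, netWeight, hadj]

open scoped Classical in
lemma partZ_eq_sum_acyclic (G : SimpleGraph V) (c : Sym2 V → ℝ) (o : V) :
    partZ G c = ∑ f ∈ Finset.univ.filter (fun f : V → Option V => IsAcyclicMap f),
      ∏ u, killedWeight G c o u (f u) := by
  have h1 : ∑ f ∈ Finset.univ.filter (fun f : V → Option V => IsParentMap G o f),
      ∏ u, killedWeight G c o u (f u) =
      ∑ f ∈ Finset.univ.filter (fun f : V → Option V => IsAcyclicMap f),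
      ∏ u, killedWeight G c o u (f u) := by
    refine Finset.sum_subset (fun f hf => ?_) (fun f hf hf' => ?_)
    · simp only [Finset.mem_filter, Finset.mem_univ, true_and] at hf ⊢
      exact hf.1
    · simp only [Finset.mem_filter, Finset.mem_univ, true_and] at hf hf'
      by_contra h
      exact hf' (hf.isParentMap_of_prod_ne_zero h)
  rw [← h1, partZ]
  symm
  refine Finset.sum_bij (fun f _ => parentEdges o f) ?_ ?_ ?_ ?_
  · intro f hf
    exact IsParentMap.parentEdges_mem (by simpa using hf)
  · intro f hf g hg h
    exact IsParentMap.parentEdges_injective (by simpa using hf) (by simpa using hg) h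
  · intro T hT
    obtain ⟨f, hf, rfl⟩ := exists_isParentMap o hT
    exact ⟨f, by simpa using hf, rfl⟩
  · intro f hf
    exact IsParentMap.prod_eq_treeWeight (by simpa using hf)

/-- The Laplacian of a weight function, grounded at `o` through a unit conductance. -/
def groundedLap (w : V → V → ℝ) (o : V) : Matrix V V ℝ :=
  Matrix.of fun u x =>
    (if u = x then (∑ y, w u y) + (if u = o then 1 else 0) else 0) - w u x

/-- The weighted matrix tree theorem. -/
theorem det_groundedLap (G : SimpleGraph V) (c : Sym2 V → ℝ) (o : V) :
    (groundedLap (netWeight G c) o).det = partZ G c := by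
  classical
  rw [partZ_eq_sum_acyclic G c o]
  convert det_laplacian_eq_sum_acyclic (killedWeight G c o) using 2
  ext u x
  simp only [groundedLap, Matrix.of_apply, Fintype.sum_option, killedWeight]
  by_cases h : u = x
  · subst h
    simp [mul_sub, Finset.sum_sub_distrib]
    ring
  · simp [h]

end MatrixTree

section Determinants

open scoped MatrixOrder Matrix.Norms.L2Operator in
lemma _root_.Matrix.PosSemidef.exists_eq_transpose_mul_self {A : Matrix V V ℝ}
    (hA : A.PosSemidef) : ∃ C : Matrix V V ℝ, A = C.transpose * C := by
  obtain ⟨C, hC⟩ := CStarAlgebra.nonneg_iff_eq_star_mul_self.mp hA.nonneg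
  exact ⟨C, by rw [hC, Matrix.star_eq_conjTranspose, Matrix.conjTranspose_eq_transpose_of_trivial]⟩

lemma det_one_add_le_exp_trace {N : Matrix V V ℝ} (hN : N.PosSemidef) :
    (1 + N).det ≤ Real.exp N.trace := by
  have h1 : (1 + N).PosSemidef := Matrix.PosSemidef.one.add hN
  have ht : (∑ i, (h1.1.eigenvalues i - 1)) = N.trace := by
    have := h1.1.trace_eq_sum_eigenvalues
    rw [Matrix.trace_add, Matrix.trace_one] at this
    simp only [RCLike.ofReal_real_eq_id, id_eq] at this
    rw [Finset.sum_sub_distrib, ← this]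
    simp
  rw [h1.1.det_eq_prod_eigenvalues, ← ht, Real.exp_sum]
  refine Finset.prod_le_prod (fun i _ => h1.eigenvalues_nonneg i) fun i _ => ?_
  have := Real.add_one_le_exp (h1.1.eigenvalues i - 1)
  simpa using this

lemma det_add_le_det_mul_exp_trace {A K : Matrix V V ℝ} (hA : A.PosDef) (hK : K.PosSemidef) :
    (A + K).det ≤ A.det * Real.exp (A⁻¹ * K).trace := by
  obtain ⟨C, hC⟩ := hA.inv.posSemidef.exists_eq_transpose_mul_self
  have hu : IsUnit A.det := (Matrix.isUnit_iff_isUnit_det A).1 hA.isUnit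
  have h1 : A + K = A * (1 + A⁻¹ * K) := by
    rw [Matrix.mul_add, Matrix.mul_one, Matrix.mul_nonsing_inv_cancel_left A K hu]
  have h2 : (1 + A⁻¹ * K).det = (1 + C * K * C.transpose).det := by
    rw [hC, Matrix.mul_assoc, Matrix.det_one_add_mul_comm]
  have h3 : (A⁻¹ * K).trace = (C * K * C.transpose).trace := by
    rw [hC, Matrix.mul_assoc, Matrix.trace_mul_comm]
  have h4 : (C * K * C.transpose).PosSemidef := by
    have := hK.mul_mul_conjTranspose_same C
    rwa [Matrix.conjTranspose_eq_transpose_of_trivial] at this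
  rw [h1, Matrix.det_mul, h2, h3]
  exact mul_le_mul_of_nonneg_left (det_one_add_le_exp_trace h4) hA.det_pos.le

lemma det_add_smul_vecMulVec {A : Matrix V V ℝ} (hA : A.PosDef) (s : ℝ) (b : V → ℝ) :
    (A + s • Matrix.vecMulVec b b).det = A.det * (1 + s * (b ⬝ᵥ A⁻¹.mulVec b)) := by
  have hu : IsUnit A.det := (Matrix.isUnit_iff_isUnit_det A).1 hA.isUnit
  rw [← Matrix.smul_vecMulVec, Matrix.vecMulVec_eq Unit,
    Matrix.det_add_replicateCol_mul_replicateRow hu]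
  congr 1
  rw [Matrix.det_unique]
  simp [Matrix.mul_apply, Matrix.replicateCol_apply, dotProduct, Matrix.mulVec, Finset.mul_sum,
    Finset.sum_mul]
  rw [Finset.sum_comm]
  refine Finset.sum_congr rfl fun i _ => Finset.sum_congr rfl fun j _ => by ring

lemma sq_dotProduct_le_inv_form {A : Matrix V V ℝ} (hA : A.PosDef) (b y : V → ℝ) :
    (b ⬝ᵥ y) ^ 2 ≤ (b ⬝ᵥ A⁻¹.mulVec b) * (y ⬝ᵥ A.mulVec y) := by
  have hu : IsUnit A.det := (Matrix.isUnit_iff_isUnit_det A).1 hA.isUnit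
  set g := A⁻¹.mulVec b with hg
  have hAg : A.mulVec g = b := by
    rw [hg, Matrix.mulVec_mulVec, Matrix.mul_nonsing_inv A hu, Matrix.one_mulVec]
  have hsymm : ∀ x z : V → ℝ, x ⬝ᵥ A.mulVec z = z ⬝ᵥ A.mulVec x := by
    intro x z
    have hT : A.transpose = A := by
      rw [← Matrix.conjTranspose_eq_transpose_of_trivial]; exact hA.1
    rw [Matrix.dotProduct_mulVec, ← Matrix.mulVec_transpose, hT, dotProduct_comm]
  have key : ∀ t : ℝ, 0 ≤ (y ⬝ᵥ A.mulVec y) * (t * t) + (-2 * (b ⬝ᵥ y)) * t + (b ⬝ᵥ g) := by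
    intro t
    have h := hA.posSemidef.dotProduct_mulVec_nonneg (g - t • y)
    have h2 : star (g - t • y) ⬝ᵥ A.mulVec (g - t • y) =
        (y ⬝ᵥ A.mulVec y) * (t * t) + (-2 * (b ⬝ᵥ y)) * t + (b ⬝ᵥ g) := by
      rw [star_trivial, Matrix.mulVec_sub, Matrix.mulVec_smul, hAg]
      simp only [dotProduct_sub, sub_dotProduct, dotProduct_smul, smul_dotProduct, smul_eq_mul]
      rw [hsymm g y, hAg, dotProduct_comm g b, dotProduct_comm y b]
      ring
    rwa [h2] at h
  have := discrim_le_zero key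
  unfold discrim at this
  nlinarith

end Determinants

section Laplacian

/-- The Laplacian matrix of a weight function. -/
def weightLap (w : V → V → ℝ) : Matrix V V ℝ :=
  Matrix.of fun u x => (if u = x then ∑ y, w u y else 0) - w u x

lemma groundedLap_eq (w : V → V → ℝ) (o : V) :
    groundedLap w o = weightLap w + Matrix.single o o 1 := by
  ext u x
  simp only [groundedLap, weightLap, Matrix.of_apply, Matrix.add_apply, Matrix.single_apply]
  by_cases h : u = x
  · subst h
    by_cases h' : u = o
    · subst h'; simp; ring
    · simp [h', Ne.symm h']
  · have : ¬ (o = u ∧ o = x) := fun hh => h (hh.1.symm.trans hh.2)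
    simp [h, this]

lemma weightLap_add (w w' : V → V → ℝ) : weightLap (w + w') = weightLap w + weightLap w' := by
  ext u x
  simp only [weightLap, Matrix.of_apply, Matrix.add_apply, Pi.add_apply, Finset.sum_add_distrib]
  split_ifs <;> ring

lemma weightLap_sum {ι : Type} (s : Finset ι) (w : ι → V → V → ℝ) :
    weightLap (∑ i ∈ s, w i) = ∑ i ∈ s, weightLap (w i) := by
  classical
  induction s using Finset.induction_on with
  | empty => ext u x; simp [weightLap]
  | insert i s hi ih => rw [Finset.sum_insert hi, Finset.sum_insert hi, weightLap_add, ih]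

lemma dotProduct_weightLap {w : V → V → ℝ} (hw : ∀ x y, w x y = w y x) (y : V → ℝ) :
    y ⬝ᵥ (weightLap w).mulVec y = (∑ u, ∑ x, w u x * (y u - y x) ^ 2) / 2 := by
  have h1 : y ⬝ᵥ (weightLap w).mulVec y = ∑ u, ∑ x, w u x * (y u * (y u - y x)) := by
    simp only [dotProduct, Matrix.mulVec, weightLap, Matrix.of_apply, sub_mul,
      Finset.sum_sub_distrib, ite_mul, zero_mul, Finset.sum_ite_eq, Finset.mem_univ, if_true,
      mul_sub, Finset.mul_sum, Finset.sum_mul]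
    congr 1
    · exact Finset.sum_congr rfl fun i _ => Finset.sum_congr rfl fun j _ => by ring
    · exact Finset.sum_congr rfl fun i _ => Finset.sum_congr rfl fun j _ => by ring
  have h2 : ∑ u, ∑ x, w u x * (y u * (y u - y x)) = ∑ u, ∑ x, w u x * (y x * (y x - y u)) := by
    rw [Finset.sum_comm]
    exact Finset.sum_congr rfl fun i _ => Finset.sum_congr rfl fun j _ => by rw [hw]
  have h3 : ∑ u, ∑ x, w u x * (y u - y x) ^ 2 =
      ∑ u, ∑ x, w u x * (y u * (y u - y x)) + ∑ u, ∑ x, w u x * (y x * (y x - y u)) := by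
    rw [← Finset.sum_add_distrib]
    refine Finset.sum_congr rfl fun i _ => ?_
    rw [← Finset.sum_add_distrib]
    exact Finset.sum_congr rfl fun j _ => by ring
  rw [h1, h3, ← h2]; ring

lemma weightLap_posSemidef {w : V → V → ℝ} (hw : ∀ x y, w x y = w y x)
    (hw0 : ∀ x y, 0 ≤ w x y) : (weightLap w).PosSemidef := by
  refine Matrix.PosSemidef.of_dotProduct_mulVec_nonneg ?_ fun y => ?_
  · ext u x
    simp only [weightLap, Matrix.conjTranspose_apply, Matrix.of_apply, star_trivial]
    rw [hw x u]
    by_cases h : u = x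
    · subst h; rfl
    · simp [h, Ne.symm h]
  · rw [star_trivial, dotProduct_weightLap hw]
    have : 0 ≤ ∑ u, ∑ x, w u x * (y u - y x) ^ 2 :=
      Finset.sum_nonneg fun u _ => Finset.sum_nonneg fun x _ => mul_nonneg (hw0 u x) (sq_nonneg _)
    linarith

lemma dotProduct_groundedLap {w : V → V → ℝ} (hw : ∀ x y, w x y = w y x) (o : V) (y : V → ℝ) :
    y ⬝ᵥ (groundedLap w o).mulVec y =
      (∑ u, ∑ x, w u x * (y u - y x) ^ 2) / 2 + y o ^ 2 := by
  rw [groundedLap_eq, Matrix.add_mulVec, dotProduct_add, dotProduct_weightLap hw,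
    Matrix.single_mulVec]
  simp [dotProduct, Function.update_apply, sq]

/-- The signed indicator of an oriented edge. -/
def edgeVec (p q : V) : V → ℝ := Pi.single p 1 - Pi.single q 1

/-- The weight function supported on the edge `{p, q}`. -/
def edgeWeight (t : ℝ) (p q : V) (u x : V) : ℝ := if s(u, x) = s(p, q) then t else 0

lemma weightLap_edgeWeight (t : ℝ) {p q : V} (hpq : p ≠ q) :
    weightLap (edgeWeight t p q) = t • Matrix.vecMulVec (edgeVec p q) (edgeVec p q) := by
  have hs : ∀ u, ∑ y, edgeWeight t p q u y = (if u = p then t else 0) + if u = q then t else 0 := by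
    intro u
    simp only [edgeWeight, Sym2.eq_iff]
    by_cases h1 : u = p
    · subst h1; simp [hpq]
    · by_cases h2 : u = q
      · subst h2; simp [h1]
      · simp [h1, h2]
  ext u x
  simp only [weightLap, Matrix.of_apply, Matrix.smul_apply, Matrix.vecMulVec_apply, edgeVec,
    Pi.sub_apply, Pi.single_apply, smul_eq_mul, edgeWeight, Sym2.eq_iff]
  by_cases h1 : u = p <;> by_cases h2 : u = q <;> by_cases h3 : x = p <;> by_cases h4 : x = q <;>
    by_cases h5 : u = x <;> simp_all

lemma trace_mul_smul_vecMulVec (N : Matrix V V ℝ) (t : ℝ) (b : V → ℝ) :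
    (N * (t • Matrix.vecMulVec b b)).trace = t * (b ⬝ᵥ N.mulVec b) := by
  rw [Matrix.mul_smul, Matrix.trace_smul, Matrix.mul_vecMulVec, Matrix.trace_vecMulVec,
    dotProduct_comm, smul_eq_mul]

end Laplacian

section TreeProbabilities

variable {G : SimpleGraph V} {c : Sym2 V → ℝ}

lemma netWeight_symm (G : SimpleGraph V) (c : Sym2 V → ℝ) (x y : V) :
    netWeight G c x y = netWeight G c y x := by
  classical
  unfold netWeight
  exact if_congr (G.adj_comm x y) (by rw [Sym2.eq_swap]) rfl

lemma netWeight_nonneg (hpos : ∀ e ∈ G.edgeSet, 0 < c e) (x y : V) : 0 ≤ netWeight G c x y := by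
  unfold netWeight
  split_ifs with h
  · exact (hpos _ h).le
  · exact le_rfl

lemma netWeight_self (G : SimpleGraph V) (c : Sym2 V → ℝ) (x : V) : netWeight G c x x = 0 := by
  simp [netWeight]

lemma netWeight_of_adj {x y : V} (h : G.Adj x y) : netWeight G c x y = c s(x, y) := by
  simp [netWeight, h]

lemma netWeight_of_not_adj {x y : V} (h : ¬ G.Adj x y) : netWeight G c x y = 0 := by
  simp [netWeight, h]

lemma posDef_groundedLap (hconn : G.Connected) (hpos : ∀ e ∈ G.edgeSet, 0 < c e) (o : V) :
    (groundedLap (netWeight G c) o).PosDef := by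
  have hs := netWeight_symm G c
  refine Matrix.PosDef.of_dotProduct_mulVec_pos ?_ fun y hy => ?_
  · ext u x
    simp only [groundedLap, Matrix.conjTranspose_apply, Matrix.of_apply, star_trivial]
    rw [hs x u]
    by_cases h : u = x
    · subst h; rfl
    · simp [h, Ne.symm h]
  · rw [star_trivial, dotProduct_groundedLap hs]
    have hterm : ∀ u x, 0 ≤ netWeight G c u x * (y u - y x) ^ 2 := fun u x =>
      mul_nonneg (netWeight_nonneg hpos u x) (sq_nonneg _)
    have h0 : 0 ≤ ∑ u, ∑ x, netWeight G c u x * (y u - y x) ^ 2 :=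
      Finset.sum_nonneg fun u _ => Finset.sum_nonneg fun x _ => hterm u x
    by_contra hle
    have hS : ∑ u, ∑ x, netWeight G c u x * (y u - y x) ^ 2 = 0 := by
      nlinarith [sq_nonneg (y o)]
    have hyo : y o = 0 := by
      have : y o ^ 2 = 0 := by nlinarith [sq_nonneg (y o)]
      exact pow_eq_zero_iff (two_ne_zero) |>.1 this
    have hadj : ∀ u x, G.Adj u x → y u = y x := by
      intro u x h
      have h1 := (Finset.sum_eq_zero_iff_of_nonneg
        (fun u _ => Finset.sum_nonneg fun x _ => hterm u x)).1 hS u (Finset.mem_univ u)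
      have h2 := (Finset.sum_eq_zero_iff_of_nonneg (fun x _ => hterm u x)).1 h1 x
        (Finset.mem_univ x)
      rw [netWeight_of_adj h] at h2
      have h3 := (mul_eq_zero.1 h2).resolve_left (hpos _ h).ne'
      exact sub_eq_zero.1 (pow_eq_zero_iff (two_ne_zero) |>.1 h3)
    apply hy
    ext u
    obtain ⟨p⟩ := hconn.preconnected u o
    rw [Pi.zero_apply, ← hyo]
    clear hyo hle
    induction p with
    | nil => rfl
    | cons h _ ih => exact (hadj _ _ h).trans ih

lemma treeWeight_pos (hpos : ∀ e ∈ G.edgeSet, 0 < c e) {T : Finset (Sym2 V)}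
    (hT : T ∈ spanningTrees G) : 0 < treeWeight c T :=
  Finset.prod_pos fun e he => hpos e ((mem_spanningTrees.1 hT).1 he)

lemma partZ_pos (hconn : G.Connected) (hpos : ∀ e ∈ G.edgeSet, 0 < c e) : 0 < partZ G c := by
  obtain ⟨o⟩ := hconn.nonempty
  rw [← det_groundedLap G c o]
  exact (posDef_groundedLap hconn hpos o).det_pos

/-- The expectation of a functional of the weighted spanning tree. -/
def treeMean (G : SimpleGraph V) (c : Sym2 V → ℝ) (F : Finset (Sym2 V) → ℝ) : ℝ :=
  (∑ T ∈ spanningTrees G, treeWeight c T * F T) / partZ G c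

lemma treeMean_mono (hconn : G.Connected) (hpos : ∀ e ∈ G.edgeSet, 0 < c e)
    {F F' : Finset (Sym2 V) → ℝ} (h : ∀ T ∈ spanningTrees G, F T ≤ F' T) :
    treeMean G c F ≤ treeMean G c F' := by
  refine div_le_div_of_nonneg_right (Finset.sum_le_sum fun T hT => ?_) (partZ_pos hconn hpos).le
  exact mul_le_mul_of_nonneg_left (h T hT) (treeWeight_pos hpos hT).le

lemma treeMean_sum {ι : Type} (s : Finset ι) (F : ι → Finset (Sym2 V) → ℝ) :
    treeMean G c (fun T => ∑ i ∈ s, F i T) = ∑ i ∈ s, treeMean G c (F i) := by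
  simp only [treeMean, Finset.mul_sum, ← Finset.sum_div]
  rw [Finset.sum_comm]

lemma treeMean_const_mul (a : ℝ) (F : Finset (Sym2 V) → ℝ) :
    treeMean G c (fun T => a * F T) = a * treeMean G c F := by
  simp only [treeMean, mul_left_comm _ a, ← Finset.mul_sum, mul_div_assoc]

lemma treeMean_add (F F' : Finset (Sym2 V) → ℝ) :
    treeMean G c (fun T => F T + F' T) = treeMean G c F + treeMean G c F' := by
  simp only [treeMean, mul_add, Finset.sum_add_distrib, add_div]

lemma treeMean_const (hconn : G.Connected) (hpos : ∀ e ∈ G.edgeSet, 0 < c e) (a : ℝ) :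
    treeMean G c (fun _ => a) = a := by
  simp only [treeMean, ← Finset.sum_mul]
  exact mul_div_cancel_left₀ a (partZ_pos hconn hpos).ne'

lemma treeMean_congr {F F' : Finset (Sym2 V) → ℝ} (h : ∀ T ∈ spanningTrees G, F T = F' T) :
    treeMean G c F = treeMean G c F' := by
  unfold treeMean
  rw [Finset.sum_congr rfl fun T hT => by rw [h T hT]]

lemma treeMean_nonneg (hconn : G.Connected) (hpos : ∀ e ∈ G.edgeSet, 0 < c e)
    {F : Finset (Sym2 V) → ℝ} (h : ∀ T ∈ spanningTrees G, 0 ≤ F T) : 0 ≤ treeMean G c F := by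
  rw [← treeMean_const hconn hpos 0]
  exact treeMean_mono hconn hpos h

/-- The probability that an edge belongs to the weighted spanning tree. -/
def edgeProb (G : SimpleGraph V) (c : Sym2 V → ℝ) (e : Sym2 V) : ℝ :=
  treeMean G c fun T => if e ∈ T then 1 else 0

/-- Doubling the conductances of the edges in `s`. -/
def doubledOn (s : Sym2 V → Prop) [DecidablePred s] (c : Sym2 V → ℝ) (e : Sym2 V) : ℝ :=
  if s e then 2 * c e else c e

lemma treeWeight_doubledOn (s : Sym2 V → Prop) [DecidablePred s] (T : Finset (Sym2 V)) :
    treeWeight (doubledOn s c) T = treeWeight c T * 2 ^ (T.filter s).card := by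
  have : ∀ e, doubledOn s c e = c e * if s e then 2 else 1 := by
    intro e
    unfold doubledOn
    split_ifs <;> ring
  simp only [treeWeight, this, Finset.prod_mul_distrib, Finset.prod_ite, Finset.prod_const, one_pow,
    mul_one]

lemma partZ_doubledOn (hconn : G.Connected) (hpos : ∀ e ∈ G.edgeSet, 0 < c e)
    (s : Sym2 V → Prop) [DecidablePred s] :
    partZ G (doubledOn s c) =
      partZ G c * treeMean G c fun T => 2 ^ (T.filter s).card := by
  rw [treeMean, mul_div_cancel₀ _ (partZ_pos hconn hpos).ne', partZ]
  exact Finset.sum_congr rfl fun T _ => treeWeight_doubledOn s T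

/-- Kirchhoff's effective resistance formula. -/
lemma edgeProb_eq (hconn : G.Connected) (hpos : ∀ e ∈ G.edgeSet, 0 < c e) (o : V) {p q : V}
    (hpq : G.Adj p q) :
    edgeProb G c s(p, q) = netWeight G c p q *
      (edgeVec p q ⬝ᵥ (groundedLap (netWeight G c) o)⁻¹.mulVec (edgeVec p q)) := by
  have hA := posDef_groundedLap hconn hpos o
  have h1 : netWeight G (doubledOn (· = s(p, q)) c) =
      netWeight G c + edgeWeight (netWeight G c p q) p q := by
    ext u x
    simp only [Pi.add_apply, edgeWeight, netWeight, doubledOn, hpq, if_true]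
    by_cases h : s(u, x) = s(p, q)
    · have hux : G.Adj u x := by
        rw [← SimpleGraph.mem_edgeSet, h]; exact hpq
      simp [h, hux]; ring
    · simp [h]
  have h2 : groundedLap (netWeight G (doubledOn (· = s(p, q)) c)) o =
      groundedLap (netWeight G c) o +
        netWeight G c p q • Matrix.vecMulVec (edgeVec p q) (edgeVec p q) := by
    rw [h1, groundedLap_eq, groundedLap_eq, weightLap_add, weightLap_edgeWeight _ hpq.ne]
    abel
  have h3 := det_groundedLap G (doubledOn (· = s(p, q)) c) o
  rw [h2, det_add_smul_vecMulVec hA, det_groundedLap, partZ_doubledOn hconn hpos] at h3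
  have h4 := mul_left_cancel₀ (partZ_pos hconn hpos).ne' h3
  have h5 : (treeMean G c fun T => (2 : ℝ) ^ (T.filter (· = s(p, q))).card) =
      1 + edgeProb G c s(p, q) := by
    have : (treeMean G c fun T => 1 + if s(p, q) ∈ T then (1 : ℝ) else 0) =
        1 + edgeProb G c s(p, q) := by
      rw [treeMean_add, treeMean_const hconn hpos]; rfl
    rw [← this]
    refine treeMean_congr fun T _ => ?_
    rw [Finset.filter_eq']
    split_ifs <;> norm_num
  rw [h5] at h4
  linarith

lemma edgeProb_of_not_adj {p q : V} (h : ¬ G.Adj p q) : edgeProb G c s(p, q) = 0 := by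
  have : ∀ T ∈ spanningTrees G, (if s(p, q) ∈ T then (1 : ℝ) else 0) = 0 := by
    intro T hT
    exact if_neg fun hm => h ((mem_spanningTrees.1 hT).1 hm)
  rw [edgeProb, treeMean_congr this]
  simp [treeMean]

/-- The degree of a vertex in an edge set. -/
def treeDeg (T : Finset (Sym2 V)) (v : V) : ℕ := (Finset.univ.filter fun x => s(v, x) ∈ T).card

lemma card_filter_mem_eq_treeDeg (T : Finset (Sym2 V)) (v : V) :
    (T.filter (v ∈ ·)).card = treeDeg T v := by
  have : T.filter (v ∈ ·) = (Finset.univ.filter fun x => s(v, x) ∈ T).image fun x => s(v, x) := by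
    ext e
    simp only [Finset.mem_filter, Finset.mem_image, Finset.mem_univ, true_and]
    constructor
    · rintro ⟨he, hv⟩
      obtain ⟨x, rfl⟩ := hv
      exact ⟨x, he, rfl⟩
    · rintro ⟨x, hx, rfl⟩
      exact ⟨hx, Sym2.mem_mk_left v x⟩
  rw [this, treeDeg, Finset.card_image_of_injective]
  intro x y h
  exact Sym2.congr_right.1 h

/-- The expected degree of a vertex in the weighted spanning tree. -/
def meanDeg (G : SimpleGraph V) (c : Sym2 V → ℝ) (v : V) : ℝ := ∑ x, edgeProb G c s(v, x)

lemma treeMean_treeDeg (v : V) : (treeMean G c fun T => (treeDeg T v : ℝ)) = meanDeg G c v := by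
  simp only [meanDeg, edgeProb, ← treeMean_sum]
  exact treeMean_congr fun T _ => by simp [treeDeg]

/-- The exponential moment bound coming from negative dependence of the edges at a vertex. -/
lemma treeMean_two_pow_treeDeg_le (hconn : G.Connected) (hpos : ∀ e ∈ G.edgeSet, 0 < c e) (v : V) :
    (treeMean G c fun T => (2 : ℝ) ^ treeDeg T v) ≤ Real.exp (meanDeg G c v) := by
  have hA := posDef_groundedLap hconn hpos v
  set K := ∑ x, weightLap (edgeWeight (netWeight G c v x) v x) with hK
  have h1 : netWeight G (doubledOn (v ∈ ·) c) =
      netWeight G c + ∑ x, edgeWeight (netWeight G c v x) v x := by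
    ext u y
    simp only [Pi.add_apply, Finset.sum_apply, edgeWeight, Sym2.eq_iff]
    by_cases h : G.Adj u y
    · rw [netWeight_of_adj h, netWeight_of_adj h, doubledOn]
      simp only [Sym2.mem_iff]
      by_cases hu : v = u
      · subst hu
        have : ∀ x, (v = v ∧ y = x ∨ v = x ∧ y = v) ↔ y = x := fun x =>
          ⟨fun hh => hh.elim (fun z => z.2) (fun z => (h.ne z.2.symm).elim),
            fun hh => Or.inl ⟨rfl, hh⟩⟩
        rw [if_pos (Or.inl rfl), two_mul]
        congr 1
        refine Eq.trans ?_ (Finset.sum_congr rfl fun x _ => (if_congr (this x) rfl rfl).symm)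
        rw [Finset.sum_ite_eq, if_pos (Finset.mem_univ _), netWeight_of_adj h]
      · by_cases hy : v = y
        · subst hy
          have : ∀ x, (u = v ∧ v = x ∨ u = x ∧ v = v) ↔ u = x := fun x =>
            ⟨fun hh => hh.elim (fun z => (hu z.1.symm).elim) (fun z => z.1),
              fun hh => Or.inr ⟨hh, rfl⟩⟩
          rw [if_pos (Or.inr rfl), two_mul]
          congr 1
          refine Eq.trans ?_ (Finset.sum_congr rfl fun x _ => (if_congr (this x) rfl rfl).symm)
          rw [Finset.sum_ite_eq, if_pos (Finset.mem_univ _), netWeight_of_adj h.symm, Sym2.eq_swap]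
        · simp [hu, hy, Ne.symm hu, Ne.symm hy]
    · rw [netWeight_of_not_adj h, netWeight_of_not_adj h]
      symm
      rw [zero_add]
      refine Finset.sum_eq_zero fun x _ => ?_
      split_ifs with hh
      · rcases hh with ⟨rfl, rfl⟩ | ⟨rfl, rfl⟩
        · exact netWeight_of_not_adj h
        · exact netWeight_of_not_adj fun h' => h h'.symm
      · rfl
  have h2 : groundedLap (netWeight G (doubledOn (v ∈ ·) c)) v =
      groundedLap (netWeight G c) v + K := by
    rw [h1, groundedLap_eq, groundedLap_eq, weightLap_add, weightLap_sum]
    abel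
  have hKpos : K.PosSemidef := by
    rw [hK, ← weightLap_sum]
    refine weightLap_posSemidef (fun x y => ?_) fun x y => ?_
    · simp only [Finset.sum_apply, edgeWeight, Sym2.eq_swap (a := x)]
    · simp only [Finset.sum_apply, edgeWeight]
      refine Finset.sum_nonneg fun z _ => ?_
      split_ifs
      · exact netWeight_nonneg hpos _ _
      · exact le_rfl
  have htr : ((groundedLap (netWeight G c) v)⁻¹ * K).trace = meanDeg G c v := by
    rw [hK, Finset.mul_sum, Matrix.trace_sum, meanDeg]
    refine Finset.sum_congr rfl fun x _ => ?_
    by_cases h : G.Adj v x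
    · rw [weightLap_edgeWeight _ h.ne, trace_mul_smul_vecMulVec, edgeProb_eq hconn hpos v h]
    · rw [edgeProb_of_not_adj h, netWeight_of_not_adj h]
      have : weightLap (edgeWeight 0 v x) = 0 := by
        ext i j; simp [weightLap, edgeWeight]
      simp [this]
  have h3 := det_add_le_det_mul_exp_trace hA hKpos
  rw [← h2, det_groundedLap, det_groundedLap, htr, partZ_doubledOn hconn hpos] at h3
  have h4 := le_of_mul_le_mul_left h3 (partZ_pos hconn hpos)
  simpa only [card_filter_mem_eq_treeDeg] using h4

lemma sum_treeDeg {T : Finset (Sym2 V)} (hT : T ∈ spanningTrees G) :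
    ∑ v, treeDeg T v + 2 = 2 * Fintype.card V := by
  classical
  have hsub := (mem_spanningTrees.1 hT).1
  have hcard := card_add_one_of_mem_spanningTrees hT
  have h := (SimpleGraph.fromEdgeSet (↑T : Set (Sym2 V))).sum_degrees_eq_twice_card_edges
  have hE : ∀ inst : Fintype (SimpleGraph.fromEdgeSet (↑T : Set (Sym2 V))).edgeSet,
      @SimpleGraph.edgeFinset _ _ inst = T := by
    intro inst
    ext e
    rw [SimpleGraph.mem_edgeFinset, edgeSet_fromEdgeSet_of_subset hsub, Finset.mem_coe]
  rw [hE] at h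
  have hd : ∀ v, (SimpleGraph.fromEdgeSet (↑T : Set (Sym2 V))).degree v = treeDeg T v := by
    intro v
    rw [treeDeg, ← SimpleGraph.card_neighborFinset_eq_degree]
    congr 1
    ext x
    simp only [SimpleGraph.mem_neighborFinset, SimpleGraph.fromEdgeSet_adj, Finset.mem_coe,
      Finset.mem_filter, Finset.mem_univ, true_and, and_iff_left_iff_imp]
    intro hx
    exact (show G.Adj v x from hsub hx).ne
  simp only [hd] at h
  omega

lemma sum_meanDeg (hconn : G.Connected) (hpos : ∀ e ∈ G.edgeSet, 0 < c e) :
    ∑ v, meanDeg G c v = 2 * Fintype.card V - 2 := by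
  simp only [← treeMean_treeDeg, ← treeMean_sum]
  rw [← treeMean_const hconn hpos (G := G) (c := c) (2 * Fintype.card V - 2)]
  refine treeMean_congr fun T hT => ?_
  have := sum_treeDeg hT
  have h2 : ((∑ v, treeDeg T v + 2 : ℕ) : ℝ) = ((2 * Fintype.card V : ℕ) : ℝ) := by rw [this]
  push_cast at h2
  linarith

/-- The total conductance at a vertex. -/
def totalWeight (G : SimpleGraph V) (c : Sym2 V → ℝ) (v : V) : ℝ := ∑ x, netWeight G c v x

lemma vertCond_eq_totalWeight [DecidableRel G.Adj] (v : V) :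
    vertCond G c v = totalWeight G c v := by
  rw [vertCond, totalWeight, ← Finset.sum_subset (Finset.subset_univ (G.neighborFinset v))
    fun x _ hx => netWeight_of_not_adj fun h => hx ((G.mem_neighborFinset v x).2 h)]
  refine Finset.sum_congr rfl fun x hx => ?_
  rw [netWeight_of_adj ((G.mem_neighborFinset v x).1 hx), Sym2.eq_swap]

lemma sub_sq_le_edgeProb (hconn : G.Connected) (hpos : ∀ e ∈ G.edgeSet, 0 < c e) (p q : V) :
    (netWeight G c p q / totalWeight G c p + netWeight G c p q / totalWeight G c q) -
      (netWeight G c p q / totalWeight G c p + netWeight G c p q / totalWeight G c q) ^ 2 ≤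
    edgeProb G c s(p, q) := by
  by_cases hpq : G.Adj p q
  swap
  · simp [netWeight_of_not_adj hpq, edgeProb_of_not_adj hpq]
  have hw0 := netWeight_nonneg hpos
  have ht : 0 < netWeight G c p q := by rw [netWeight_of_adj hpq]; exact hpos _ hpq
  have hP : 0 < totalWeight G c p :=
    ht.trans_le (Finset.single_le_sum (fun x _ => hw0 p x) (Finset.mem_univ q))
  have hQ : 0 < totalWeight G c q := by
    rw [netWeight_symm] at ht
    exact ht.trans_le (Finset.single_le_sum (fun x _ => hw0 q x) (Finset.mem_univ p))
  set t := netWeight G c p q with htd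
  set P := totalWeight G c p with hPd
  set Q := totalWeight G c q with hQd
  have hne := hpq.ne
  set θ := P / (P + Q) with hθ
  let y : V → ℝ := fun x => if x = p then 1 else if x = q then 0 else θ
  have hyp : y p = 1 := by simp [y]
  have hyq : y q = 0 := by simp [y, hne.symm]
  have hyo : ∀ x, x ≠ p → x ≠ q → y x = θ := fun x h1 h2 => by simp [y, h1, h2]
  have hcs := sq_dotProduct_le_inv_form (posDef_groundedLap hconn hpos q) (edgeVec p q) y
  have hby : edgeVec p q ⬝ᵥ y = 1 := by
    simp [edgeVec, sub_dotProduct, hyp, hyq]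
  rw [hby, dotProduct_groundedLap (netWeight_symm G c), hyq] at hcs
  have hpt : ∀ u x, netWeight G c u x * (y u - y x) ^ 2 ≤
      netWeight G c u x * ((if u = p then (1 - θ) ^ 2 else 0) + (if u = q then θ ^ 2 else 0)) +
      netWeight G c u x * ((if x = p then (1 - θ) ^ 2 else 0) + (if x = q then θ ^ 2 else 0)) +
      edgeWeight t p q u x := by
    intro u x
    have hEW : 0 ≤ edgeWeight t p q u x := by
      unfold edgeWeight; split_ifs
      · exact ht.le
      · exact le_rfl
    have hw := hw0 u x
    have ha := mul_nonneg hw (sq_nonneg θ)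
    have hb := mul_nonneg hw (sq_nonneg (1 - θ))
    by_cases hux : u = x
    · subst hux
      rw [netWeight_self]; simpa using hEW
    by_cases hup : u = p
    · subst hup
      by_cases hxq : x = q
      · subst hxq
        have : edgeWeight t u x u x = t := by simp [edgeWeight]
        rw [this, hyp, hyq]
        simp only [hne, hne.symm, if_true, if_false]
        nlinarith
      · rw [hyp, hyo x (Ne.symm hux) hxq]
        simp only [hne, Ne.symm hux, hxq, if_true, if_false]
        nlinarith
    · by_cases huq : u = q
      · subst huq
        by_cases hxp : x = p
        · subst hxp
          have : edgeWeight t x u u x = t := by simp [edgeWeight, Sym2.eq_swap]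
          rw [this, hyp, hyq]
          have htt : netWeight G c u x = t := by rw [netWeight_symm]
          simp only [hne, hne.symm, if_true, if_false]
          nlinarith
        · rw [hyq, hyo x hxp (Ne.symm hux)]
          simp only [hne.symm, Ne.symm hux, hxp, if_true, if_false]
          nlinarith
      · rw [hyo u hup huq]
        by_cases hxp : x = p
        · subst hxp
          rw [hyp]
          simp only [hne, hup, huq, if_true, if_false]
          nlinarith
        · by_cases hxq : x = q
          · subst hxq
            rw [hyq]
            simp only [hne.symm, hup, huq, if_true, if_false]
            nlinarith
          · rw [hyo x hxp hxq]
            simp only [hup, huq, hxp, hxq, if_false]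
            nlinarith
  have hsum1 : ∑ u, ∑ x, netWeight G c u x *
      ((if u = p then (1 - θ) ^ 2 else 0) + (if u = q then θ ^ 2 else 0)) =
      P * (1 - θ) ^ 2 + Q * θ ^ 2 := by
    have : ∀ u, ∑ x, netWeight G c u x *
        ((if u = p then (1 - θ) ^ 2 else 0) + (if u = q then θ ^ 2 else 0)) =
        totalWeight G c u *
          ((if u = p then (1 - θ) ^ 2 else 0) + (if u = q then θ ^ 2 else 0)) := fun u =>
      (Finset.sum_mul ..).symm
    rw [Finset.sum_congr rfl fun u _ => this u]
    simp only [mul_add, Finset.sum_add_distrib, mul_ite, mul_zero,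
      Finset.sum_ite_eq', Finset.mem_univ, if_true, ← hPd, ← hQd]
  have hsum2 : ∑ u, ∑ x, netWeight G c u x *
      ((if x = p then (1 - θ) ^ 2 else 0) + (if x = q then θ ^ 2 else 0)) =
      P * (1 - θ) ^ 2 + Q * θ ^ 2 := by
    rw [Finset.sum_comm, ← hsum1]
    exact Finset.sum_congr rfl fun u _ => Finset.sum_congr rfl fun x _ => by
      rw [netWeight_symm]
  have hsum3 : ∑ u, ∑ x, edgeWeight t p q u x = 2 * t := by
    have hs : ∀ u, ∑ y, edgeWeight t p q u y =
        (if u = p then t else 0) + if u = q then t else 0 := by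
      intro u
      simp only [edgeWeight, Sym2.eq_iff]
      by_cases h1 : u = p
      · subst h1; simp [hne]
      · by_cases h2 : u = q
        · subst h2; simp [h1]
        · simp [h1, h2]
    simp only [hs, Finset.sum_add_distrib, Finset.sum_ite_eq', Finset.mem_univ, if_true]
    ring
  have hE : (∑ u, ∑ x, netWeight G c u x * (y u - y x) ^ 2) / 2 ≤
      P * (1 - θ) ^ 2 + Q * θ ^ 2 + t := by
    have := Finset.sum_le_sum fun u (_ : u ∈ Finset.univ) =>
      Finset.sum_le_sum fun x (_ : x ∈ Finset.univ) => hpt u x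
    simp only [Finset.sum_add_distrib] at this
    rw [hsum1, hsum2, hsum3] at this
    linarith
  have hθe : P * (1 - θ) ^ 2 + Q * θ ^ 2 = P * Q / (P + Q) := by
    rw [hθ]; field_simp; ring
  rw [hθe] at hE
  rw [edgeProb_eq hconn hpos q hpq, ← htd]
  set R := edgeVec p q ⬝ᵥ (groundedLap (netWeight G c) q)⁻¹.mulVec (edgeVec p q) with hR
  have hR0 : 0 ≤ R := by
    have := (posDef_groundedLap hconn hpos q).inv.posSemidef.dotProduct_mulVec_nonneg (edgeVec p q)
    rwa [star_trivial] at this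
  have hRE : 1 ≤ R * (P * Q / (P + Q) + t) := by
    refine le_trans ?_ (mul_le_mul_of_nonneg_left hE hR0)
    simpa using hcs
  have hs : t / P + t / Q = t * ((P + Q) / (P * Q)) := by field_simp; ring
  rw [hs]
  set σ := (P + Q) / (P * Q) with hσ
  have hσ0 : 0 < σ := by positivity
  have hσi : P * Q / (P + Q) = 1 / σ := by rw [hσ]; field_simp
  rw [hσi] at hRE
  have h1 : σ ≤ R * (1 + t * σ) := by
    have := mul_le_mul_of_nonneg_right hRE hσ0.le
    have h2 : R * (1 / σ + t) * σ = R * (1 + t * σ) := by field_simp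
    linarith
  have h3 : 0 ≤ t * σ := by positivity
  have h4 : t * σ ≤ (t * R) * (1 + t * σ) := by
    have := mul_le_mul_of_nonneg_left h1 ht.le
    linarith
  by_contra hlt
  push Not at hlt
  have h5 : (t * R) * (1 + t * σ) < (t * σ - (t * σ) ^ 2) * (1 + t * σ) :=
    mul_lt_mul_of_pos_right hlt (by linarith)
  nlinarith [pow_nonneg h3 3]

end TreeProbabilities

section LocalEstimates

variable {G : SimpleGraph V} {c : Sym2 V → ℝ}

/-- The transition probabilities of the random walk on the network. -/
def stepProb (G : SimpleGraph V) (c : Sym2 V → ℝ) (u v : V) : ℝ :=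
  netWeight G c u v / totalWeight G c u

lemma totalWeight_nonneg (hpos : ∀ e ∈ G.edgeSet, 0 < c e) (v : V) : 0 ≤ totalWeight G c v :=
  Finset.sum_nonneg fun x _ => netWeight_nonneg hpos v x

lemma totalWeight_pos_of_adj (hpos : ∀ e ∈ G.edgeSet, 0 < c e) {u x : V} (h : G.Adj u x) :
    0 < totalWeight G c u := by
  have h1 : 0 < netWeight G c u x := by rw [netWeight_of_adj h]; exact hpos _ h
  exact h1.trans_le
    (Finset.single_le_sum (fun x _ => netWeight_nonneg hpos u x) (Finset.mem_univ x))

lemma totalWeight_pos (hconn : G.Connected) (hpos : ∀ e ∈ G.edgeSet, 0 < c e) {v : V}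
    (hv : 0 < totalWeight G c v) (u : V) : 0 < totalWeight G c u := by
  obtain ⟨p⟩ := hconn.preconnected u v
  cases p with
  | nil => exact hv
  | cons h _ => exact totalWeight_pos_of_adj hpos h

lemma stepProb_nonneg (hpos : ∀ e ∈ G.edgeSet, 0 < c e) (u v : V) : 0 ≤ stepProb G c u v :=
  div_nonneg (netWeight_nonneg hpos u v) (totalWeight_nonneg hpos u)

lemma sum_stepProb {u : V} (hu : 0 < totalWeight G c u) : ∑ v, stepProb G c u v = 1 := by
  simp only [stepProb, ← Finset.sum_div]
  exact div_self (ne_of_gt hu)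

/-- The excess of an edge probability over a lower bound coming from its local conductances. -/
def edgeExcess (G : SimpleGraph V) (c : Sym2 V → ℝ) (u v : V) : ℝ :=
  edgeProb G c s(u, v) - (stepProb G c u v + stepProb G c v u) +
    (stepProb G c u v + stepProb G c v u) ^ 2

lemma edgeExcess_nonneg (hconn : G.Connected) (hpos : ∀ e ∈ G.edgeSet, 0 < c e) (u v : V) :
    0 ≤ edgeExcess G c u v := by
  have h := sub_sq_le_edgeProb hconn hpos u v
  have h1 : netWeight G c u v / totalWeight G c v = stepProb G c v u := by
    rw [stepProb, netWeight_symm]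
  rw [h1, ← stepProb] at h
  unfold edgeExcess
  linarith

/-- The non-asymptotic form, for a single network, of the assumption that most vertices have
conductance of order `γ` and that all edges have negligible conductance. -/
structure LocallyLight (G : SimpleGraph V) (c : Sym2 V → ℝ) (K γ δ : ℝ) : Prop where
  connected : G.Connected
  pos : ∀ e ∈ G.edgeSet, 0 < c e
  scale_pos : 0 < γ
  lt_one : δ < 1
  one_lt : 1 < K
  card_le : (1 - δ) * (Fintype.card V : ℝ) ≤
    (Finset.univ.filter fun v : V => totalWeight G c v ∈ Set.Icc γ (K * γ)).card
  sum_le : ∑ v ∈ Finset.univ.filter (fun v : V => totalWeight G c v ∉ Set.Icc γ (K * γ)),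
    totalWeight G c v ≤ δ * γ * (Fintype.card V : ℝ)
  edge_le : ∀ x y, netWeight G c x y ≤ δ * γ

/-- The indicator of an atypical vertex. -/
def atypical (G : SimpleGraph V) (c : Sym2 V → ℝ) (K γ : ℝ) (v : V) : ℝ :=
  if totalWeight G c v ∈ Set.Icc γ (K * γ) then 0 else 1

/-- The error in the local bound for the expected degree. -/
def degreeError (G : SimpleGraph V) (c : Sym2 V → ℝ) (K γ : ℝ) (v : V) : ℝ :=
  ∑ u, edgeExcess G c v u + ∑ u, atypical G c K γ u * stepProb G c u v +
    atypical G c K γ v * (totalWeight G c v / γ)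

lemma atypical_nonneg (K γ : ℝ) (v : V) : 0 ≤ atypical G c K γ v := by
  unfold atypical; split_ifs <;> norm_num

lemma sq_le_two_mul_two_pow (k : ℕ) : k ^ 2 ≤ 2 * 2 ^ k := by
  rcases lt_or_ge k 3 with hk | hk
  · interval_cases k <;> norm_num
  · induction k, hk using Nat.le_induction with
    | base => norm_num
    | succ k hk ih =>
      rw [pow_succ 2 k]
      nlinarith

namespace LocallyLight

variable {K γ δ : ℝ}

lemma delta_nonneg (h : LocallyLight G c K γ δ) : 0 ≤ δ := by
  obtain ⟨o⟩ := h.connected.nonempty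
  have := h.edge_le o o
  rw [netWeight_self] at this
  exact nonneg_of_mul_nonneg_left this h.scale_pos

lemma card_pos (h : LocallyLight G c K γ δ) : (0 : ℝ) < Fintype.card V := by
  have := h.connected.nonempty
  exact_mod_cast Fintype.card_pos

lemma weight_pos (h : LocallyLight G c K γ δ) (u : V) : 0 < totalWeight G c u := by
  have h1 : (0 : ℝ) <
      (Finset.univ.filter fun v : V => totalWeight G c v ∈ Set.Icc γ (K * γ)).card :=
    (mul_pos (sub_pos.2 h.lt_one) h.card_pos).trans_le h.card_le
  obtain ⟨v, hv⟩ := Finset.card_pos.1 (Nat.cast_pos.1 h1)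
  exact totalWeight_pos h.connected h.pos
    (h.scale_pos.trans_le (Finset.mem_filter.1 hv).2.1) u

lemma sum_atypical_le (h : LocallyLight G c K γ δ) :
    ∑ v, atypical G c K γ v ≤ δ * Fintype.card V := by
  have h1 : ∑ v, atypical G c K γ v +
      (Finset.univ.filter fun v : V => totalWeight G c v ∈ Set.Icc γ (K * γ)).card =
      Fintype.card V := by
    rw [Finset.card_filter]
    push_cast
    rw [← Finset.sum_add_distrib]
    have : ∀ v, atypical G c K γ v +
        (if totalWeight G c v ∈ Set.Icc γ (K * γ) then (1 : ℝ) else 0) = 1 := by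
      intro v; unfold atypical; split_ifs <;> norm_num
    simp only [this]
    simp
  linarith [h.card_le]

lemma sum_atypical_mul_weight_le (h : LocallyLight G c K γ δ) :
    ∑ v, atypical G c K γ v * (totalWeight G c v / γ) ≤ δ * Fintype.card V := by
  have h1 : ∑ v, atypical G c K γ v * (totalWeight G c v / γ) =
      (∑ v ∈ Finset.univ.filter (fun v : V => totalWeight G c v ∉ Set.Icc γ (K * γ)),
        totalWeight G c v) / γ := by
    rw [Finset.sum_filter, Finset.sum_div]
    refine Finset.sum_congr rfl fun v _ => ?_
    unfold atypical
    split_ifs <;> simp_all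
  rw [h1, div_le_iff₀ h.scale_pos]
  linarith [h.sum_le]

lemma stepProb_le_one (h : LocallyLight G c K γ δ) (u v : V) : stepProb G c u v ≤ 1 := by
  rw [← sum_stepProb (h.weight_pos u)]
  exact Finset.single_le_sum (fun x _ => stepProb_nonneg h.pos u x) (Finset.mem_univ v)

lemma stepProb_le (h : LocallyLight G c K γ δ) (u v : V) :
    stepProb G c u v ≤ δ + atypical G c K γ u := by
  unfold atypical
  split_ifs with hu
  · rw [add_zero, stepProb, div_le_iff₀ (h.weight_pos u)]
    exact (h.edge_le u v).trans (mul_le_mul_of_nonneg_left hu.1 h.delta_nonneg)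
  · linarith [h.stepProb_le_one u v, h.delta_nonneg]

lemma sum_sq_stepProb_le (h : LocallyLight G c K γ δ) :
    ∑ u, ∑ v, stepProb G c u v ^ 2 ≤ 2 * δ * Fintype.card V := by
  have h1 : ∀ u, ∑ v, stepProb G c u v ^ 2 ≤ δ + atypical G c K γ u := by
    intro u
    calc ∑ v, stepProb G c u v ^ 2 ≤ ∑ v, (δ + atypical G c K γ u) * stepProb G c u v := by
          refine Finset.sum_le_sum fun v _ => ?_
          rw [sq]
          exact mul_le_mul_of_nonneg_right (h.stepProb_le u v) (stepProb_nonneg h.pos u v)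
      _ = δ + atypical G c K γ u := by
          rw [← Finset.mul_sum, sum_stepProb (h.weight_pos u), mul_one]
  calc ∑ u, ∑ v, stepProb G c u v ^ 2 ≤ ∑ u, (δ + atypical G c K γ u) :=
        Finset.sum_le_sum fun u _ => h1 u
    _ = δ * Fintype.card V + ∑ u, atypical G c K γ u := by
        simp [Finset.sum_add_distrib, mul_comm]
    _ ≤ _ := by linarith [h.sum_atypical_le]

lemma sum_edgeExcess_le (h : LocallyLight G c K γ δ) :
    ∑ v, ∑ u, edgeExcess G c v u ≤ 8 * δ * Fintype.card V := by
  have h1 : ∑ v, ∑ u, stepProb G c v u = Fintype.card V := by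
    simp [sum_stepProb (h.weight_pos _)]
  have h2 : ∑ v, ∑ u, stepProb G c u v = Fintype.card V := by
    rw [Finset.sum_comm, h1]
  have h3 := sum_meanDeg h.connected h.pos
  simp only [meanDeg] at h3
  have h4 := h.sum_sq_stepProb_le
  have h5 : ∑ v, ∑ u, stepProb G c u v ^ 2 ≤ 2 * δ * Fintype.card V := by
    rw [Finset.sum_comm]; exact h4
  have h6 : ∑ v, ∑ u, edgeExcess G c v u ≤
      ∑ v, ∑ u, (edgeProb G c s(v, u) - (stepProb G c v u + stepProb G c u v) +
        (2 * stepProb G c v u ^ 2 + 2 * stepProb G c u v ^ 2)) := by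
    refine Finset.sum_le_sum fun v _ => Finset.sum_le_sum fun u _ => ?_
    unfold edgeExcess
    nlinarith [sq_nonneg (stepProb G c v u - stepProb G c u v)]
  simp only [Finset.sum_add_distrib, Finset.sum_sub_distrib, ← Finset.mul_sum] at h6
  linarith

lemma sum_degreeError_le (h : LocallyLight G c K γ δ) :
    ∑ v, degreeError G c K γ v ≤ 10 * δ * Fintype.card V := by
  have h1 : ∑ v, ∑ u, atypical G c K γ u * stepProb G c u v = ∑ u, atypical G c K γ u := by
    rw [Finset.sum_comm]
    simp only [← Finset.mul_sum, sum_stepProb (h.weight_pos _), mul_one]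
  simp only [degreeError, Finset.sum_add_distrib, h1]
  linarith [h.sum_edgeExcess_le, h.sum_atypical_le, h.sum_atypical_mul_weight_le]

lemma degreeError_nonneg (h : LocallyLight G c K γ δ) (v : V) : 0 ≤ degreeError G c K γ v := by
  refine add_nonneg (add_nonneg ?_ ?_) ?_
  · exact Finset.sum_nonneg fun u _ => edgeExcess_nonneg h.connected h.pos v u
  · exact Finset.sum_nonneg fun u _ =>
      mul_nonneg (atypical_nonneg K γ u) (stepProb_nonneg h.pos u v)
  · exact mul_nonneg (atypical_nonneg K γ v) (div_nonneg (h.weight_pos v).le h.scale_pos.le)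

lemma meanDeg_le (h : LocallyLight G c K γ δ) (v : V) :
    meanDeg G c v ≤ K + 1 + degreeError G c K γ v := by
  have h1 : ∀ u, stepProb G c u v ≤
      atypical G c K γ u * stepProb G c u v + netWeight G c v u / γ := by
    intro u
    rw [netWeight_symm G c v u]
    have hw := netWeight_nonneg h.pos u v
    unfold atypical
    split_ifs with hu
    · rw [zero_mul, zero_add]
      exact div_le_div_of_nonneg_left hw h.scale_pos hu.1
    · linarith [div_nonneg hw h.scale_pos.le]
  have h2 : totalWeight G c v / γ ≤ K + atypical G c K γ v * (totalWeight G c v / γ) := by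
    unfold atypical
    split_ifs with hv
    · rw [zero_mul, add_zero, div_le_iff₀ h.scale_pos]
      exact hv.2
    · linarith [h.one_lt]
  have h3 : meanDeg G c v ≤ ∑ u, (edgeExcess G c v u + (stepProb G c v u +
      (atypical G c K γ u * stepProb G c u v + netWeight G c v u / γ))) := by
    refine Finset.sum_le_sum fun u _ => ?_
    have := sq_nonneg (stepProb G c v u + stepProb G c u v)
    unfold edgeExcess
    linarith [h1 u]
  simp only [Finset.sum_add_distrib, ← Finset.sum_div, sum_stepProb (h.weight_pos _)] at h3
  rw [← totalWeight] at h3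
  unfold degreeError
  linarith

lemma treeMean_truncated_le (h : LocallyLight G c K γ δ) (v : V) {L : ℕ} (hL : 0 < L) :
    (treeMean G c fun T => if L < treeDeg T v then (treeDeg T v : ℝ) else 0) ≤
      2 * Real.exp (K + 2) / L + (K + 2) * degreeError G c K γ v := by
  have hL' : (0 : ℝ) < L := by exact_mod_cast hL
  have hε := h.degreeError_nonneg v
  have hm := h.meanDeg_le v
  have hK := h.one_lt
  by_cases h1 : degreeError G c K γ v ≤ 1
  · have h2 : (treeMean G c fun T => if L < treeDeg T v then (treeDeg T v : ℝ) else 0) ≤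
        treeMean G c fun T => 2 / L * 2 ^ treeDeg T v := by
      refine treeMean_mono h.connected h.pos fun T _ => ?_
      split_ifs with hT
      · have h3 : ((treeDeg T v : ℝ)) ^ 2 ≤ 2 * 2 ^ treeDeg T v := by
          exact_mod_cast sq_le_two_mul_two_pow (treeDeg T v)
        have h4 : (L : ℝ) ≤ treeDeg T v := by exact_mod_cast hT.le
        rw [div_mul_eq_mul_div, le_div_iff₀ hL']
        nlinarith
      · positivity
    rw [treeMean_const_mul] at h2
    have h5 := (treeMean_two_pow_treeDeg_le h.connected h.pos v).trans
      (Real.exp_le_exp.2 (by linarith : meanDeg G c v ≤ K + 2))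
    have h6 : 2 / (L : ℝ) * treeMean G c (fun T => (2 : ℝ) ^ treeDeg T v) ≤
        2 / L * Real.exp (K + 2) := mul_le_mul_of_nonneg_left h5 (by positivity)
    have h7 : 2 / (L : ℝ) * Real.exp (K + 2) = 2 * Real.exp (K + 2) / L := by ring
    have h8 : 0 ≤ (K + 2) * degreeError G c K γ v := mul_nonneg (by linarith) hε
    linarith
  · have h2 : (treeMean G c fun T => if L < treeDeg T v then (treeDeg T v : ℝ) else 0) ≤
        meanDeg G c v := by
      rw [← treeMean_treeDeg]
      refine treeMean_mono h.connected h.pos fun T _ => ?_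
      split_ifs
      · exact le_rfl
      · positivity
    have h3 : 0 ≤ 2 * Real.exp (K + 2) / L := by positivity
    nlinarith

lemma sum_treeMean_truncated_le (h : LocallyLight G c K γ δ) {L : ℕ} (hL : 0 < L) :
    ∑ v, (treeMean G c fun T => if L < treeDeg T v then (treeDeg T v : ℝ) else 0) ≤
      (2 * Real.exp (K + 2) / L + 10 * (K + 2) * δ) * Fintype.card V := by
  refine (Finset.sum_le_sum fun v _ => h.treeMean_truncated_le v hL).trans ?_
  rw [Finset.sum_add_distrib, ← Finset.mul_sum, Finset.sum_const, Finset.card_univ, nsmul_eq_mul]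
  have := mul_le_mul_of_nonneg_left h.sum_degreeError_le (by linarith [h.one_lt] : 0 ≤ K + 2)
  linarith

end LocallyLight

end LocalEstimates

section BallRecursion

variable {G : SimpleGraph V} {c : Sym2 V → ℝ}

lemma ballSet_zero (H : SimpleGraph V) (x : V) : ballSet H x 0 ⊆ {x} := by
  rintro y ⟨hr, hd⟩
  exact (hr.dist_eq_zero_iff.1 (Nat.le_zero.1 hd)).symm

lemma ballSet_succ_subset (H : SimpleGraph V) (x : V) (r : ℕ) :
    ballSet H x (r + 1) ⊆ {x} ∪ ⋃ y ∈ {y | H.Adj x y}, ballSet H y r := by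
  rintro z ⟨hr, hd⟩
  obtain ⟨p, hp⟩ := hr.exists_walk_length_eq_dist
  cases p with
  | nil => exact Or.inl rfl
  | cons h q =>
    rw [SimpleGraph.Walk.length_cons] at hp
    refine Or.inr (Set.mem_iUnion₂.2 ⟨_, h, ⟨q⟩, ?_⟩)
    have := SimpleGraph.dist_le q
    omega

/-- The indicator that the ball of radius `r` around `x` has at least `M` vertices. -/
def bigBall (T : Finset (Sym2 V)) (r M : ℕ) (x : V) : ℝ :=
  if M ≤ (ballSet (SimpleGraph.fromEdgeSet (↑T : Set (Sym2 V))) x r).ncard then 1 else 0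

lemma bigBall_nonneg (T : Finset (Sym2 V)) (r M : ℕ) (x : V) : 0 ≤ bigBall T r M x := by
  unfold bigBall; split_ifs <;> norm_num

lemma bigBall_le_one (T : Finset (Sym2 V)) (r M : ℕ) (x : V) : bigBall T r M x ≤ 1 := by
  unfold bigBall; split_ifs <;> norm_num

lemma bigBall_anti (T : Finset (Sym2 V)) (r : ℕ) {M M' : ℕ} (h : M ≤ M') (x : V) :
    bigBall T r M' x ≤ bigBall T r M x := by
  unfold bigBall
  split_ifs with h1 h2
  · exact le_rfl
  · exact absurd (h.trans h1) h2
  · norm_num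
  · exact le_rfl

lemma wstBallBigProb_eq (r M : ℕ) :
    wstBallBigProb G c r M =
      (Fintype.card V : ℝ)⁻¹ * ∑ x, treeMean G c fun T => bigBall T r M x := by
  unfold wstBallBigProb treeMean bigBall
  simp only [mul_ite, mul_one, mul_zero]

lemma ncard_ballSet_succ_le (T : Finset (Sym2 V)) (r : ℕ) (x : V) :
    (ballSet (SimpleGraph.fromEdgeSet (↑T : Set (Sym2 V))) x (r + 1)).ncard ≤
      1 + ∑ y ∈ Finset.univ.filter (fun y => s(x, y) ∈ T),
        (ballSet (SimpleGraph.fromEdgeSet (↑T : Set (Sym2 V))) y r).ncard := by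
  set H := SimpleGraph.fromEdgeSet (↑T : Set (Sym2 V)) with hH
  have h1 : ballSet H x (r + 1) ⊆
      {x} ∪ ⋃ y ∈ Finset.univ.filter (fun y => s(x, y) ∈ T), ballSet H y r := by
    refine (ballSet_succ_subset H x r).trans (Set.union_subset_union_right _ ?_)
    refine Set.biUnion_subset_biUnion_left fun y hy => ?_
    have := (SimpleGraph.fromEdgeSet_adj _).1 (show H.Adj x y from hy)
    simpa using this.1
  refine (Set.ncard_le_ncard h1 (Set.toFinite _)).trans ((Set.ncard_union_le _ _).trans ?_)
  rw [Set.ncard_singleton]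
  exact Nat.add_le_add_left (Finset.set_ncard_biUnion_le _ _) 1

lemma bigBall_succ_le (T : Finset (Sym2 V)) (r L M : ℕ) (x : V) :
    bigBall T (r + 1) (2 + L * M) x ≤
      (if L < treeDeg T x then (treeDeg T x : ℝ) else 0) +
        ∑ y, if s(x, y) ∈ T then bigBall T r M y else 0 := by
  have hs : 0 ≤ ∑ y, if s(x, y) ∈ T then bigBall T r M y else 0 :=
    Finset.sum_nonneg fun y _ => by
      split_ifs
      · exact bigBall_nonneg T r M y
      · exact le_rfl
  by_cases hL : L < treeDeg T x
  · rw [if_pos hL]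
    have : (1 : ℝ) ≤ treeDeg T x := by exact_mod_cast (Nat.zero_le L).trans_lt hL
    linarith [bigBall_le_one T (r + 1) (2 + L * M) x]
  · rw [if_neg hL, zero_add]
    by_cases hy : ∃ y, s(x, y) ∈ T ∧
        M ≤ (ballSet (SimpleGraph.fromEdgeSet (↑T : Set (Sym2 V))) y r).ncard
    · obtain ⟨y, hyT, hyM⟩ := hy
      have h1 : (1 : ℝ) ≤ ∑ y, if s(x, y) ∈ T then bigBall T r M y else 0 := by
        refine le_trans (le_of_eq ?_) (Finset.single_le_sum (fun y _ => ?_) (Finset.mem_univ y))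
        · rw [if_pos hyT, bigBall, if_pos hyM]
        · split_ifs
          · exact bigBall_nonneg T r M y
          · exact le_rfl
      exact (bigBall_le_one ..).trans h1
    · push Not at hy
      rw [bigBall, if_neg]
      · exact hs
      · have h1 := ncard_ballSet_succ_le T r x
        have h2 : ∑ y ∈ Finset.univ.filter (fun y => s(x, y) ∈ T),
            (ballSet (SimpleGraph.fromEdgeSet (↑T : Set (Sym2 V))) y r).ncard ≤
            treeDeg T x * M := by
          rw [treeDeg, ← smul_eq_mul]
          exact Finset.sum_le_card_nsmul _ _ _ fun y hy' =>
            (hy y (Finset.mem_filter.1 hy').2).le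
        have h3 : treeDeg T x * M ≤ L * M := Nat.mul_le_mul_right M (not_lt.1 hL)
        omega

lemma sum_bigBall_succ_le (T : Finset (Sym2 V)) (r L M : ℕ) :
    ∑ x, bigBall T (r + 1) (2 + L * M) x ≤
      2 * ∑ x, (if L < treeDeg T x then (treeDeg T x : ℝ) else 0) +
        L * ∑ x, bigBall T r M x := by
  have h1 : ∑ x, ∑ y, (if s(x, y) ∈ T then bigBall T r M y else 0) =
      ∑ y, treeDeg T y * bigBall T r M y := by
    rw [Finset.sum_comm]
    refine Finset.sum_congr rfl fun y _ => ?_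
    rw [← Finset.sum_filter, Finset.sum_const, nsmul_eq_mul, treeDeg]
    simp only [Sym2.eq_swap (a := y)]
  have h2 : ∑ y, treeDeg T y * bigBall T r M y ≤
      ∑ y, ((if L < treeDeg T y then (treeDeg T y : ℝ) else 0) + L * bigBall T r M y) := by
    refine Finset.sum_le_sum fun y _ => ?_
    have h0 := bigBall_nonneg T r M y
    split_ifs with hL
    · have := mul_le_mul_of_nonneg_left (bigBall_le_one T r M y)
        (Nat.cast_nonneg (α := ℝ) (treeDeg T y))
      have h3 : 0 ≤ (L : ℝ) * bigBall T r M y := by positivity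
      linarith
    · rw [zero_add]
      exact mul_le_mul_of_nonneg_right (by exact_mod_cast not_lt.1 hL) h0
  have h3 := Finset.sum_le_sum fun x (_ : x ∈ Finset.univ) => bigBall_succ_le T r L M x
  rw [Finset.sum_add_distrib] at h3 h2
  rw [← Finset.mul_sum] at h2
  linarith

lemma wstBallBigProb_anti (hconn : G.Connected) (hpos : ∀ e ∈ G.edgeSet, 0 < c e) (r : ℕ)
    {M M' : ℕ} (h : M ≤ M') : wstBallBigProb G c r M' ≤ wstBallBigProb G c r M := by
  rw [wstBallBigProb_eq, wstBallBigProb_eq]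
  exact mul_le_mul_of_nonneg_left (Finset.sum_le_sum fun x _ =>
    treeMean_mono hconn hpos fun T _ => bigBall_anti T r h x) (by positivity)

lemma wstBallBigProb_nonneg (hconn : G.Connected) (hpos : ∀ e ∈ G.edgeSet, 0 < c e) (r M : ℕ) :
    0 ≤ wstBallBigProb G c r M := by
  rw [wstBallBigProb_eq]
  exact mul_nonneg (by positivity) (Finset.sum_nonneg fun x _ =>
    treeMean_nonneg hconn hpos fun T _ => bigBall_nonneg T r M x)

lemma wstBallBigProb_eq_zero {r M : ℕ}
    (h : ∀ T : Finset (Sym2 V), ∀ x,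
      (ballSet (SimpleGraph.fromEdgeSet (↑T : Set (Sym2 V))) x r).ncard < M) :
    wstBallBigProb G c r M = 0 := by
  have : ∀ T : Finset (Sym2 V), ∀ x, bigBall T r M x = 0 := fun T x =>
    if_neg (not_le.2 (h T x))
  simp [wstBallBigProb_eq, this, treeMean]

lemma LocallyLight.wstBallBigProb_succ_le {K γ δ : ℝ} (h : LocallyLight G c K γ δ) (r M : ℕ)
    {L : ℕ} (hL : 0 < L) :
    wstBallBigProb G c (r + 1) (2 + L * M) ≤
      2 * (2 * Real.exp (K + 2) / L + 10 * (K + 2) * δ) + L * wstBallBigProb G c r M := by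
  have h1 : ∑ x, treeMean G c (fun T => bigBall T (r + 1) (2 + L * M) x) ≤
      2 * ∑ x, (treeMean G c fun T => if L < treeDeg T x then (treeDeg T x : ℝ) else 0) +
        L * ∑ x, treeMean G c fun T => bigBall T r M x := by
    simp only [← treeMean_sum, ← treeMean_const_mul, ← treeMean_add]
    exact treeMean_mono h.connected h.pos fun T _ => sum_bigBall_succ_le T r L M
  have hN := h.card_pos
  rw [wstBallBigProb_eq, wstBallBigProb_eq, inv_mul_le_iff₀ hN]
  refine h1.trans ?_
  have h2 := h.sum_treeMean_truncated_le hL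
  have h3 : (Fintype.card V : ℝ) * (L * ((Fintype.card V : ℝ)⁻¹ *
      ∑ x, treeMean G c fun T => bigBall T r M x)) =
      L * ∑ x, treeMean G c fun T => bigBall T r M x := by
    field_simp
  rw [mul_add, h3]
  linarith

end BallRecursion

/-- Uniform tightness of the ball sizes over all locally light networks. -/
lemma exists_wstBallBigProb_le {K : ℝ} (hK : 1 < K) (r : ℕ) : ∀ η : ℝ, 0 < η →
    ∃ M : ℕ, ∃ δ₀ : ℝ, 0 < δ₀ ∧ ∀ (V : Type) [Fintype V] [DecidableEq V] (G : SimpleGraph V)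
      (c : Sym2 V → ℝ) (γ δ : ℝ), LocallyLight G c K γ δ → δ ≤ δ₀ →
        wstBallBigProb G c r M ≤ η := by
  induction r with
  | zero =>
    intro η hη
    refine ⟨2, 1, one_pos, fun V _ _ G c γ δ _ _ => ?_⟩
    rw [wstBallBigProb_eq_zero]
    · exact hη.le
    · intro T x
      have := Set.ncard_le_ncard (ballSet_zero (SimpleGraph.fromEdgeSet (↑T : Set (Sym2 V))) x)
        (Set.toFinite _)
      rw [Set.ncard_singleton] at this
      omega
  | succ r ih =>
    intro η hη
    obtain ⟨L, hL⟩ := exists_nat_gt (12 * Real.exp (K + 2) / η)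
    have hL0 : (0 : ℝ) < L := lt_trans (by positivity) hL
    have hLpos : 0 < L := Nat.cast_pos.1 hL0
    obtain ⟨M, δ₀, hδ₀, hM⟩ := ih (η / (3 * L)) (by positivity)
    have hK2 : 0 < K + 2 := by linarith
    refine ⟨2 + L * M, min δ₀ (η / (60 * (K + 2))), lt_min hδ₀ (by positivity),
      fun V _ _ G c γ δ h hδ => ?_⟩
    refine (h.wstBallBigProb_succ_le r M hLpos).trans ?_
    have h1 := mul_le_mul_of_nonneg_left (hM V G c γ δ h (hδ.trans (min_le_left _ _))) hL0.le
    have h2 : (L : ℝ) * (η / (3 * L)) = η / 3 := by field_simp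
    have h3 : 2 * (2 * Real.exp (K + 2) / L) ≤ η / 3 := by
      rw [div_lt_iff₀ hη] at hL
      rw [← mul_div_assoc, div_le_iff₀ hL0]
      linarith
    have h4 : 2 * (10 * (K + 2) * δ) ≤ η / 3 := by
      have := (le_div_iff₀ (by positivity)).1 (hδ.trans (min_le_right _ _))
      linarith
    linarith

/-- tightness of the ball sizes.  If `(Gₙ, cₙ)` satisfies Assumption (LL)
for some `K > 1`, `γₙ > 0`, `δₙ → 0`, with `Gₙ` simple and `cₙ` connected, then for every
fixed radius `r`, `lim_{M→∞} sup_n P(|B_{WST(cₙ)}(X, r)| ≥ M) = 0`. -/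
theorem wst_ball_tightness
    (V : ℕ → Type) [∀ n, Fintype (V n)] [∀ n, DecidableEq (V n)]
    (G : ∀ n, SimpleGraph (V n)) [∀ n, DecidableRel (G n).Adj]
    (c : ∀ n, Sym2 (V n) → ℝ) (K : ℝ) (γ : ℕ → ℝ) (δ : ℕ → ℝ)
    (hconn : ∀ n, (G n).Connected)
    (hpos : ∀ n, ∀ e ∈ (G n).edgeSet, 0 < c n e)
    (hK : 1 < K)
    (hγ : ∀ n, 0 < γ n)
    (hδ : Tendsto δ atTop (nhds 0))
    -- Assumption (LL)(i): |Wₙ^{(tc)}| ≥ (1-δₙ)|V(Gₙ)| for all large n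
    (hW : ∀ᶠ n in atTop,
      (((Finset.univ.filter fun v : V n =>
          vertCond (G n) (c n) v ∈ Set.Icc (γ n) (K * γ n)).card : ℝ))
        ≥ (1 - δ n) * (Fintype.card (V n) : ℝ))
    -- Assumption (LL)(ii): Σ_{v ∉ Wₙ^{(tc)}} C_v ≤ δₙ·γₙ·|V(Gₙ)| for all large n
    (hWsum : ∀ᶠ n in atTop,
      (∑ v ∈ Finset.univ.filter (fun v : V n =>
          vertCond (G n) (c n) v ∉ Set.Icc (γ n) (K * γ n)), vertCond (G n) (c n) v)
        ≤ δ n * γ n * (Fintype.card (V n) : ℝ))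
    -- Assumption (LL)(iii): cₙ(e) ≤ δₙ·γₙ for all edges, for all large n
    (hc : ∀ᶠ n in atTop, ∀ e ∈ (G n).edgeSet, c n e ≤ δ n * γ n)
    (r : ℕ) :
    Tendsto (fun M : ℕ => ⨆ n : ℕ, wstBallBigProb (G n) (c n) r M) atTop (nhds 0) := by
  have hlight : ∀ᶠ n in atTop, LocallyLight (G n) (c n) K (γ n) (δ n) := by
    filter_upwards [hW, hWsum, hc, hδ.eventually_lt_const one_pos] with n h1 h2 h3 h4
    simp only [vertCond_eq_totalWeight] at h1 h2
    have hne := (hconn n).nonempty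
    have hN : (0 : ℝ) < Fintype.card (V n) := by exact_mod_cast Fintype.card_pos
    have hcard := (mul_pos (sub_pos.2 h4) hN).trans_le h1
    obtain ⟨v, hv⟩ := Finset.card_pos.1 (Nat.cast_pos.1 hcard)
    have hv' := ((hγ n).trans_le (Finset.mem_filter.1 hv).2.1).ne'
    obtain ⟨x, -, hx⟩ := Finset.exists_ne_zero_of_sum_ne_zero hv'
    have hadj : (G n).Adj v x := by
      by_contra h
      exact hx (netWeight_of_not_adj h)
    have hδγ : 0 ≤ δ n * γ n := (hpos n s(v, x) hadj).le.trans (h3 s(v, x) hadj)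
    refine ⟨hconn n, hpos n, hγ n, h4, hK, h1, h2, fun x y => ?_⟩
    by_cases h : (G n).Adj x y
    · rw [netWeight_of_adj h]
      exact h3 s(x, y) h
    · rw [netWeight_of_not_adj h]
      exact hδγ
  rw [Metric.tendsto_atTop]
  intro η hη
  obtain ⟨M₀, δ₀, hδ₀, hM₀⟩ := exists_wstBallBigProb_le hK r (η / 2) (half_pos hη)
  obtain ⟨n₀, hn₀⟩ := eventually_atTop.1 (hlight.and (hδ.eventually_lt_const hδ₀))
  refine ⟨max M₀ (1 + ∑ n ∈ Finset.range n₀, Fintype.card (V n)), fun M hM => ?_⟩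
  have hle : ∀ n, wstBallBigProb (G n) (c n) r M ≤ η / 2 := by
    intro n
    rcases lt_or_ge n n₀ with hn | hn
    · rw [wstBallBigProb_eq_zero]
      · exact (half_pos hη).le
      · intro T x
        have h1 : (ballSet (SimpleGraph.fromEdgeSet (↑T : Set (Sym2 (V n)))) x r).ncard ≤
            Fintype.card (V n) := by
          rw [← Nat.card_eq_fintype_card]
          exact Set.ncard_le_card _
        have h2 : Fintype.card (V n) ≤ ∑ n ∈ Finset.range n₀, Fintype.card (V n) :=
          Finset.single_le_sum (f := fun n => Fintype.card (V n)) (fun _ _ => Nat.zero_le _)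
            (Finset.mem_range.2 hn)
        have h3 := (le_max_right _ _).trans hM
        omega
    · exact (wstBallBigProb_anti (hconn n) (hpos n) r ((le_max_left _ _).trans hM)).trans
        (hM₀ (V n) (G n) (c n) (γ n) (δ n) (hn₀ n hn).1 (hn₀ n hn).2.le)
  rw [Real.dist_eq, sub_zero,
    abs_of_nonneg (Real.iSup_nonneg fun n => wstBallBigProb_nonneg (hconn n) (hpos n) r M)]
  exact (ciSup_le hle).trans_lt (half_lt_self hη)

end WSTPaper
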